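/- arXiv:2006.01819 — 2 statements merged into one kernel-verified Lean document; each statement's English description precedes it below -/
import Mathlib

section
/- Tchakaloff's theorem (discrete case): Let 𝒵 be a type, let z_1, …, z_N ∈ 𝒵 be N points, let w_1, …, w_N be nonnegative reals with ∑_{i=1}^N w_i = 1 (the distribution of a discrete random variable Z taking the value z_i with probability w_i), and let f_1, …, f_n : 𝒵 → ℝ be n real-valued functions. Then there exist nonnegative weights ŵ_1, …, ŵ_N with ∑_{i=1}^N ŵ_i = 1, at most n + 1 of which are nonzero, such that ∑_{i=1}^N ŵ_i f_k(z_i) = ∑_{i=1}^N w_i f_k(z_i) for every k = 1, …, n. -/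
open scoped BigOperators

/-- Tchakaloff's theorem (discrete case): a discrete probability measure on `N`
atoms can be recombined into one supported on at most `n + 1` of the atoms while
matching the expectations of `n` prescribed real-valued functions. -/
theorem tchakaloff_discrete {𝒵 : Type*} (n N : ℕ) (z : Fin N → 𝒵)
    (w : Fin N → ℝ) (hw_nonneg : ∀ i, 0 ≤ w i) (hw_sum : ∑ i, w i = 1)
    (f : Fin n → 𝒵 → ℝ) :
    ∃ what : Fin N → ℝ,
      (∀ i, 0 ≤ what i) ∧ (∑ i, what i = 1) ∧
      (Finset.univ.filter fun i => what i ≠ 0).card ≤ n + 1 ∧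
      ∀ k : Fin n, ∑ i, what i * f k (z i) = ∑ i, w i * f k (z i) := by
  classical
  let p : Fin N → (Fin n → ℝ) := fun i k => f k (z i)
  have hx : (∑ i, w i • p i) ∈ convexHull ℝ (Set.range p) :=
    (convex_convexHull ℝ _).sum_mem (fun i _ => hw_nonneg i) hw_sum
      (fun i _ => subset_convexHull ℝ _ ⟨i, rfl⟩)
  obtain ⟨ι, _, y, v, hy, hind, hv, hv1, hvx⟩ := eq_pos_convex_span_of_mem_convexHull hx
  have hg : ∀ i, ∃ j, p j = y i := fun i => hy ⟨i, rfl⟩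
  choose g hg using hg
  have key : ∀ h : Fin N → ℝ,
      ∑ j, (∑ i, if g i = j then v i else 0) * h j = ∑ i, v i * h (g i) := by
    intro h
    simp_rw [Finset.sum_mul]
    rw [Finset.sum_comm]
    simp [ite_mul]
  refine ⟨fun j => ∑ i, if g i = j then v i else 0, ?_, ?_, ?_, ?_⟩
  · intro j
    refine Finset.sum_nonneg fun i _ => ?_
    split_ifs
    · exact (hv i).le
    · exact le_rfl
  · have := key (fun _ => 1)
    simpa [hv1] using this
  · have hsub : (Finset.univ.filter fun j => (∑ i, if g i = j then v i else 0) ≠ 0)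
        ⊆ Finset.univ.image g := by
      intro j hj
      obtain ⟨i, -, hi⟩ := Finset.exists_ne_zero_of_sum_ne_zero (Finset.mem_filter.mp hj).2
      refine Finset.mem_image.mpr ⟨i, Finset.mem_univ _, ?_⟩
      by_contra hne
      exact hi (if_neg hne)
    have h1 := (Finset.card_le_card hsub).trans Finset.card_image_le
    have h2 := hind.card_le_finrank_succ
    have h3 := Submodule.finrank_le (vectorSpan ℝ (Set.range y))
    rw [Module.finrank_fin_fun] at h3
    rw [Finset.card_univ] at h1
    have h4 := h1.trans (h2.trans (Nat.succ_le_succ h3))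
    convert h4
  · intro k
    rw [key (fun j => f k (z j))]
    have h := congrFun hvx k
    simp only [Finset.sum_apply, Pi.smul_apply, smul_eq_mul, ← hg] at h
    exact h
end

section
/- The empirical logistic regression risk satisfies the hypotheses of the CaGD convergence theorems: given data x_1, …, x_N ∈ ℝ^n and labels y_1, …, y_N ∈ {−1, 1}, the function L(θ) := (1/N) ∑_{i=1}^N log(1 + exp(−y_i ⟨x_i, θ⟩)) is convex on ℝ^n, is differentiable, and its gradient is Lipschitz with constant (1/(4N)) ∑_{i=1}^N ‖x_i‖². -/
open scoped BigOperators RealInnerProductSpace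

theorem softplus_hasDerivAt (t : ℝ) :
    HasDerivAt (fun t => Real.log (1 + Real.exp t)) (Real.sigmoid t) t := by
  have hp : (0 : ℝ) < 1 + Real.exp t := by positivity
  have h := ((Real.hasDerivAt_exp t).const_add 1).log hp.ne'
  convert h using 1
  rw [Real.sigmoid_def, Real.exp_neg]
  have := Real.exp_pos t
  field_simp
  ring

theorem softplus_convex : ConvexOn ℝ Set.univ (fun t : ℝ => Real.log (1 + Real.exp t)) := by
  apply Monotone.convexOn_univ_of_deriv
  · exact fun t => (softplus_hasDerivAt t).differentiableAt
  · have : deriv (fun t : ℝ => Real.log (1 + Real.exp t)) = Real.sigmoid :=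
      funext fun t => (softplus_hasDerivAt t).deriv
    rw [this]
    exact Real.sigmoid_monotone

theorem sigmoid_lip (a b : ℝ) : |Real.sigmoid a - Real.sigmoid b| ≤ 1 / 4 * |a - b| := by
  have h := Convex.norm_image_sub_le_of_norm_deriv_le (𝕜 := ℝ) (f := Real.sigmoid) (C := 1 / 4)
    (s := Set.univ) (x := b) (y := a) (fun t _ => (Real.hasDerivAt_sigmoid t).differentiableAt)
    (fun t _ => by
      rw [(Real.hasDerivAt_sigmoid t).deriv, Real.norm_eq_abs, abs_le]
      have h0 := Real.sigmoid_pos t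
      have h1 := Real.sigmoid_lt_one t
      constructor
      · nlinarith
      · nlinarith [sq_nonneg (Real.sigmoid t - 1 / 2)])
    convex_univ (Set.mem_univ _) (Set.mem_univ _)
  simpa only [Real.norm_eq_abs] using h

/-- The empirical logistic regression risk
`L(θ) = (1/N) ∑ᵢ log(1 + exp(-yᵢ⟪xᵢ, θ⟫))` with labels `yᵢ ∈ {-1, 1}` is
convex, differentiable, and its gradient is Lipschitz with constant
`(1/(4N)) ∑ᵢ ‖xᵢ‖²`. -/
theorem logistic_regression_risk_properties {n N : ℕ}
    (x : Fin N → EuclideanSpace ℝ (Fin n)) (y : Fin N → ℝ)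
    (hy : ∀ i, y i = -1 ∨ y i = 1)
    (L : EuclideanSpace ℝ (Fin n) → ℝ)
    (hLdef : ∀ θ, L θ =
      (1 / N) * ∑ i, Real.log (1 + Real.exp (-(y i) * ⟪x i, θ⟫))) :
    ConvexOn ℝ Set.univ L ∧ Differentiable ℝ L ∧
      LipschitzWith (Real.toNNReal ((1 / (4 * N)) * ∑ i, ‖x i‖ ^ 2))
        (gradient L) := by
  have hL : L = fun θ => (1 / (N : ℝ)) * ∑ i, Real.log (1 + Real.exp (-(y i) * ⟪x i, θ⟫)) :=
    funext hLdef
  have hg : ∀ θ, HasGradientAt L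
      ((1 / (N : ℝ)) • ∑ i, (Real.sigmoid (-(y i) * ⟪x i, θ⟫) * (-(y i))) • x i) θ := by
    intro θ
    rw [hasGradientAt_iff_hasFDerivAt, hL]
    have hi : ∀ i ∈ Finset.univ, HasFDerivAt
        (fun θ => Real.log (1 + Real.exp (-(y i) * ⟪x i, θ⟫)))
        (Real.sigmoid (-(y i) * ⟪x i, θ⟫) • ((-(y i)) • innerSL ℝ (x i))) θ := by
      intro i _
      exact (softplus_hasDerivAt (-(y i) * ⟪x i, θ⟫)).comp_hasFDerivAt θ
        (((innerSL ℝ (x i)).hasFDerivAt).const_mul (-(y i)))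
    have h := (HasFDerivAt.fun_sum hi).const_mul (1 / (N : ℝ))
    refine h.congr_fderiv ?_
    ext v
    simp [inner_smul_left, sum_inner, mul_assoc]
  refine ⟨?_, fun θ => (hg θ).differentiableAt, ?_⟩
  · have hi : ∀ i, ConvexOn ℝ Set.univ
        (fun θ => Real.log (1 + Real.exp (-(y i) * ⟪x i, θ⟫))) := by
      intro i
      exact softplus_convex.comp_linearMap ((-(y i)) • (innerSL ℝ (x i))).toLinearMap
    refine ⟨convex_univ, ?_⟩
    intro a _ b _ s t hs ht hst
    rw [hLdef, hLdef, hLdef]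
    have h := Finset.sum_le_sum (s := Finset.univ) fun i _ =>
      (hi i).2 (Set.mem_univ a) (Set.mem_univ b) hs ht hst
    simp only [smul_eq_mul, Finset.sum_add_distrib, ← Finset.mul_sum] at h ⊢
    have hN : (0 : ℝ) ≤ 1 / N := by positivity
    refine (mul_le_mul_of_nonneg_left h hN).trans (le_of_eq ?_)
    ring
  · apply LipschitzWith.of_dist_le_mul
    intro a b
    rw [Real.coe_toNNReal _ (by positivity), (hg a).gradient, (hg b).gradient, dist_eq_norm,
      dist_eq_norm, ← smul_sub, ← Finset.sum_sub_distrib, norm_smul, Real.norm_of_nonneg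
      (by positivity)]
    have h : ‖∑ i, ((Real.sigmoid (-(y i) * ⟪x i, a⟫) * (-(y i))) • x i
        - (Real.sigmoid (-(y i) * ⟪x i, b⟫) * (-(y i))) • x i)‖
        ≤ ∑ i, 1 / 4 * ‖x i‖ ^ 2 * ‖a - b‖ := by
      refine norm_sum_le_of_le _ fun i _ => ?_
      have hy1 : |y i| = 1 := by rcases hy i with h | h <;> simp [h]
      rw [← sub_smul, ← sub_mul, norm_smul, norm_mul, Real.norm_eq_abs, Real.norm_eq_abs,
        abs_neg, hy1, mul_one]
      have h1 := sigmoid_lip (-(y i) * ⟪x i, a⟫) (-(y i) * ⟪x i, b⟫)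
      rw [← mul_sub, ← inner_sub_right, abs_mul, abs_neg, hy1, one_mul] at h1
      have h2 := abs_real_inner_le_norm (x i) (a - b)
      have h3 := norm_nonneg (x i)
      calc _ ≤ (1 / 4 * (‖x i‖ * ‖a - b‖)) * ‖x i‖ := by gcongr; linarith
        _ = _ := by ring
    rw [← Finset.sum_mul, ← Finset.mul_sum] at h
    refine (mul_le_mul_of_nonneg_left h (by positivity)).trans (le_of_eq ?_)
    rw [one_div_mul_eq_div, one_div_mul_eq_div, div_mul_eq_div_div]
    ring
end
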